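/- Let T be a triangulated category, S a set of objects, and K_0 ∈ T. Suppose there are morphisms K_0 → K_1 → ⋯ → K_{d+1} such that the cone of each K_i → K_{i+1} lies in ⟨S⟩_1, and the composition K_0 → K_{d+1} is zero. Then K_0 ∈ ⟨S⟩_{d+1}. -/

import Mathlib

open CategoryTheory CategoryTheory.Limits CategoryTheory.Pretriangulated

universe v u

variable {C : Type u} [Category.{v} C] [Preadditive C] [HasZeroObject C]
  [HasShift C ℤ] [∀ n : ℤ, (shiftFunctor C n).Additive] [Pretriangulated C]
  [HasBinaryBiproducts C]

/-- `Span1 S X` means `X ∈ ⟨S⟩₁`: the smallest class of objects containing `S` and closed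
under shifts, finite direct sums, and direct summands (retracts). -/
inductive Span1 (S : Set C) : C → Prop
  | of {X : C} : X ∈ S → Span1 S X
  | shift {X : C} (n : ℤ) : Span1 S X → Span1 S (X⟦n⟧)
  | sum {X Y : C} : Span1 S X → Span1 S Y → Span1 S (X ⊞ Y)
  | retract {X Y : C} : Span1 S X → ∀ (i : Y ⟶ X) (r : X ⟶ Y), i ≫ r = 𝟙 Y → Span1 S Y

/-- `Gen S m X` means `X ∈ ⟨S⟩_{m+1}`: `⟨S⟩_{m+2}` consists of direct summands of objects
`E` sitting in a distinguished triangle `A ⟶ E ⟶ B ⟶ A[1]` with `A ∈ ⟨S⟩_{m+1}` and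
`B ∈ ⟨S⟩₁`. -/
def Gen (S : Set C) : ℕ → C → Prop
  | 0, X => Span1 S X
  | m + 1, X => ∃ (A E B : C) (f : A ⟶ E) (g : E ⟶ B) (h : B ⟶ A⟦(1 : ℤ)⟧),
      Triangle.mk f g h ∈ (distTriang C) ∧ Gen S m A ∧ Span1 S B ∧
      ∃ (i : X ⟶ E) (r : E ⟶ X), i ≫ r = 𝟙 X

/-- The composite `K 0 ⟶ K n` of a chain of morphisms. -/
def compChain (K : ℕ → C) (φ : ∀ i, K i ⟶ K (i + 1)) : ∀ n, K 0 ⟶ K n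
  | 0 => 𝟙 _
  | n + 1 => compChain K φ n ≫ φ n

/-- Given `X ⟶ Y ⟶ Z` with fibers `P` and `Q`, there is an extension `W` of `Q` by `P` with a
morphism to `X` such that `X ⟶ cone (W ⟶ X)` factors through `X ⟶ Y ⟶ Z`. This substitute for
the octahedral axiom holds in any pretriangulated category. -/
lemma exists_extension_cone_factors {P X Y Q Z : C}
    {a : P ⟶ X} {b : X ⟶ Y} {c : Y ⟶ P⟦(1 : ℤ)⟧}
    {a' : Q ⟶ Y} {b' : Y ⟶ Z} {c' : Z ⟶ Q⟦(1 : ℤ)⟧}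
    (h₁ : Triangle.mk a b c ∈ distTriang C) (h₂ : Triangle.mk a' b' c' ∈ distTriang C) :
    ∃ (W X' : C) (f : P ⟶ W) (g : W ⟶ Q) (h : Q ⟶ P⟦(1 : ℤ)⟧)
      (w : W ⟶ X) (x : X ⟶ X') (k : X' ⟶ W⟦(1 : ℤ)⟧) (t : Z ⟶ X'),
      Triangle.mk f g h ∈ distTriang C ∧ Triangle.mk w x k ∈ distTriang C ∧
        b ≫ b' ≫ t = x := by
  obtain ⟨W, f, g, hW⟩ := distinguished_cocone_triangle₂ (a' ≫ c)
  obtain ⟨w, hw₁, hw₂⟩ : ∃ w : W ⟶ X, f ≫ w = a ∧ g ≫ a' = w ≫ b := by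
    obtain ⟨w, hw₁, hw₂⟩ := complete_distinguished_triangle_morphism₂ _ _ hW h₁ (𝟙 P) a'
      (by
        change (a' ≫ c) ≫ (𝟙 P)⟦(1 : ℤ)⟧' = a' ≫ c
        rw [CategoryTheory.Functor.map_id, Category.comp_id])
    exact ⟨w, hw₁.trans (Category.id_comp a), hw₂⟩
  obtain ⟨X', x, k, hX'⟩ := distinguished_cocone_triangle w
  have hwx : w ≫ x = 0 := comp_distTriang_mor_zero₁₂ _ hX'
  have hbc : b ≫ c = 0 := comp_distTriang_mor_zero₂₃ _ h₁
  obtain ⟨y, hy⟩ : ∃ y : Y ⟶ X', x = b ≫ y := Triangle.yoneda_exact₂ _ h₁ x (by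
    change a ≫ x = 0
    rw [← hw₁, Category.assoc, hwx, comp_zero])
  obtain ⟨z, hz⟩ : ∃ z : P⟦(1 : ℤ)⟧ ⟶ X', a' ≫ y = (a' ≫ c) ≫ z :=
    Triangle.yoneda_exact₃ _ hW (a' ≫ y) (by
      change g ≫ a' ≫ y = 0
      rw [← Category.assoc, hw₂, Category.assoc, ← hy, hwx])
  obtain ⟨t, ht⟩ : ∃ t : Z ⟶ X', y - c ≫ z = b' ≫ t := Triangle.yoneda_exact₂ _ h₂ _ (by
    change a' ≫ (y - c ≫ z) = 0
    rw [Preadditive.comp_sub, hz, Category.assoc, sub_self])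
  refine ⟨W, X', f, g, _, w, x, k, t, hW, hX', ?_⟩
  rw [← ht, Preadditive.comp_sub, ← hy, ← Category.assoc, hbc, zero_comp, sub_zero]

lemma Gen.retract {S : Set C} {m : ℕ} {X Y : C} (hX : Gen S m X) (i : Y ⟶ X) (r : X ⟶ Y)
    (hir : i ≫ r = 𝟙 Y) : Gen S m Y := by
  cases m with
  | zero => exact Span1.retract hX i r hir
  | succ m =>
    obtain ⟨A, E, B, f, g, h, hT, hA, hB, j, s, hjs⟩ := hX
    exact ⟨A, E, B, f, g, h, hT, hA, hB, i ≫ j, s ≫ r, by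
      rw [Category.assoc, ← Category.assoc j, hjs, Category.id_comp, hir]⟩

/-- If the cone of a morphism is in `⟨S⟩₁`, so is its fiber. -/
lemma Span1.exists_fiber {S : Set C} {X Y B : C} {f : X ⟶ Y} {g : Y ⟶ B}
    {h : B ⟶ X⟦(1 : ℤ)⟧} (hT : Triangle.mk f g h ∈ distTriang C) (hB : Span1 S B) :
    ∃ (R : C) (a : R ⟶ X) (c : Y ⟶ R⟦(1 : ℤ)⟧),
      Triangle.mk a f c ∈ distTriang C ∧ Span1 S R :=
  ⟨B⟦(-1 : ℤ)⟧, _, _, inv_rot_of_distTriang _ hT, hB.shift (-1)⟩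

/-- Some object of `⟨S⟩_{n+1}` maps to `K 0` with a cone `X` such that `K 0 ⟶ X` factors through
the composite `K 0 ⟶ K (n+1)`. -/
lemma exists_gen_cone_factors_compChain (S : Set C) (d : ℕ) (K : ℕ → C)
    (φ : ∀ i, K i ⟶ K (i + 1))
    (hcone : ∀ i, i ≤ d → ∃ (B : C) (g : K (i + 1) ⟶ B) (h : B ⟶ (K i)⟦(1 : ℤ)⟧),
      Triangle.mk (φ i) g h ∈ (distTriang C) ∧ Span1 S B) (n : ℕ) (hn : n ≤ d) :
    ∃ (W X : C) (a : W ⟶ K 0) (b : K 0 ⟶ X) (c : X ⟶ W⟦(1 : ℤ)⟧) (u : K (n + 1) ⟶ X),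
      Triangle.mk a b c ∈ distTriang C ∧ Gen S n W ∧ compChain K φ (n + 1) ≫ u = b := by
  induction n with
  | zero =>
    obtain ⟨B, g, h, hT, hB⟩ := hcone 0 hn
    obtain ⟨R, a, c, hR, hRS⟩ := Span1.exists_fiber hT hB
    exact ⟨R, _, a, _, c, 𝟙 _, hR, hRS, by simp [compChain]⟩
  | succ n ih =>
    obtain ⟨W, X, a, b, c, u, hT, hW, hu⟩ := ih (by omega)
    obtain ⟨B, g, h, hB, hBS⟩ := hcone (n + 1) hn
    obtain ⟨R, r, s, hR, hRS⟩ := Span1.exists_fiber hB hBS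
    obtain ⟨Z, p, q, hZ⟩ := distinguished_cocone_triangle (r ≫ u)
    obtain ⟨v, hv⟩ : ∃ v : K (n + 1 + 1) ⟶ Z, u ≫ p = φ (n + 1) ≫ v :=
      Triangle.yoneda_exact₂ _ hR (u ≫ p) (by
        have hrup : (r ≫ u) ≫ p = 0 := comp_distTriang_mor_zero₁₂ _ hZ
        rwa [Category.assoc] at hrup)
    obtain ⟨W', X', f', g', h', w, x, k, t, hW', hX', hx⟩ := exists_extension_cone_factors hT hZ
    refine ⟨W', X', w, x, k, v ≫ t, hX',
      ⟨W, W', R, f', g', h', hW', hW, hRS, 𝟙 _, 𝟙 _, Category.id_comp _⟩, ?_⟩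
    change (compChain K φ (n + 1) ≫ φ (n + 1)) ≫ v ≫ t = x
    rw [← hx, ← hu]
    simp only [Category.assoc]
    rw [← Category.assoc u, hv, Category.assoc]

/-- If `K 0 ⟶ K 1 ⟶ ⋯ ⟶ K (d+1)` are morphisms such that the cone of each `K i ⟶ K (i+1)`
lies in `⟨S⟩₁` and the total composite `K 0 ⟶ K (d+1)` is zero, then `K 0 ∈ ⟨S⟩_{d+1}`. -/
theorem gen_of_chain (S : Set C) (d : ℕ) (K : ℕ → C) (φ : ∀ i, K i ⟶ K (i + 1))
    (hcone : ∀ i, i ≤ d → ∃ (B : C) (g : K (i + 1) ⟶ B) (h : B ⟶ (K i)⟦(1 : ℤ)⟧),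
      Triangle.mk (φ i) g h ∈ (distTriang C) ∧ Span1 S B)
    (hzero : compChain K φ (d + 1) = 0) :
    Gen S d (K 0) := by
  obtain ⟨W, X, a, b, c, u, hT, hW, hu⟩ :=
    exists_gen_cone_factors_compChain S d K φ hcone d le_rfl
  obtain ⟨s, hs⟩ : ∃ s : K 0 ⟶ W, 𝟙 (K 0) = s ≫ a :=
    Triangle.coyoneda_exact₂ _ hT (𝟙 (K 0)) (by
      change 𝟙 (K 0) ≫ b = 0
      rw [← hu, hzero, zero_comp, comp_zero])
  exact hW.retract s a hs.symm
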